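/- Let p be an odd prime, l ≥ 2, and q = p^l. Then the F_{q^2}-dimension of the Hermitian-lifted code C_q is at least 0.469·q^3 / (p^4·(p−1)·(p^3−p^2+1)); equivalently, the rate of C_q (its dimension divided by its length q^3) is at least 0.469 / (p^4·(p−1)·(p^3−p^2+1)). -/

import Mathlib

open Polynomial in
/-- Power functions with distinct exponents smaller than `#S` are linearly independent on `S`. -/
theorem eq_zero_of_sum_mul_pow_eq_zero {F ι : Type*} [Field F] [Fintype ι] (S : Finset F)
    (n : ι → ℕ) (hn : Function.Injective n) (hlt : ∀ i, n i < S.card) (g : ι → F)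
    (h : ∀ x ∈ S, ∑ i, g i * x ^ n i = 0) (i : ι) : g i = 0 := by
  classical
  set P : F[X] := ∑ i, monomial (n i) (g i) with hP
  have hdeg : P.degree < S.card := by
    rw [← mem_degreeLT]
    refine Submodule.sum_mem _ fun i _ => mem_degreeLT.2 ?_
    exact (degree_monomial_le _ _).trans_lt (by exact_mod_cast hlt i)
  have h0 : P = 0 := by
    refine eq_zero_of_degree_lt_of_eval_finset_eq_zero S hdeg fun x hx => ?_
    simpa [hP, eval_finsetSum] using h x hx
  have hc : P.coeff (n i) = g i := by
    simp [hP, finsetSum_coeff, coeff_monomial, hn.eq_iff]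
  rw [← hc, h0, coeff_zero]

open Polynomial in
theorem card_filter_pow_add_mul_eq_le {F : Type*} [Field F] [Fintype F] [DecidableEq F]
    {q : ℕ} (hq : 1 < q) (c e : F) :
    (Finset.univ.filter fun x : F => x ^ q + c * x = e).card ≤ q := by
  have hdeg : (C c * X - C e : F[X]).degree < q := by
    refine (degree_sub_le _ _).trans_lt (max_lt ?_ ?_)
    · exact (degree_C_mul_X_le c).trans_lt (by exact_mod_cast hq)
    · exact degree_C_le.trans_lt (by exact_mod_cast (by omega : 0 < q))
  set P : F[X] := X ^ q + (C c * X - C e) with hP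
  have hm : P.Monic := monic_X_pow_add hdeg
  have hn : P.natDegree = q := by
    rw [hP, add_comm, natDegree_eq_of_degree_eq (degree_add_eq_right_of_degree_lt _),
      natDegree_X_pow]
    rwa [degree_X_pow]
  refine (Finset.card_le_card (t := P.roots.toFinset) fun x hx => ?_).trans
    ((Multiset.toFinset_card_le _).trans ((card_roots' P).trans hn.le))
  rw [Multiset.mem_toFinset, mem_roots hm.ne_zero, IsRoot.def]
  simp only [Finset.mem_filter, Finset.mem_univ, true_and] at hx
  simp [hP, ← hx]

/-- Every affine line `y = const` meets the Hermitian curve in `q` rational points. -/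
theorem le_card_hermitian_fiber {p l q : ℕ} (hp : p.Prime) (hl : l ≠ 0) (hq : q = p ^ l)
    {F : Type*} [Field F] [Fintype F] [DecidableEq F] [CharP F p] (hF : Fintype.card F = q ^ 2)
    (y : F) : q ≤ (Finset.univ.filter fun x : F => x ^ q + x + y ^ (q + 1) = 0).card := by
  have := Fact.mk hp
  have hq1 : 1 < q := hq ▸ Nat.one_lt_pow hl hp.one_lt
  have hfrob (x : F) : (x ^ q) ^ q = x := by
    rw [← pow_mul, ← sq, ← hF, FiniteField.pow_card]
  have hadd (x z : F) : (x + z) ^ q = x ^ q + z ^ q := by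
    rw [hq, add_pow_char_pow]
  let fiber (e : F) : Finset F := Finset.univ.filter fun x : F => x ^ q + x = e
  have hfib (e : F) : (fiber e).card ≤ q := by
    simpa [fiber] using card_filter_pow_add_mul_eq_le hq1 (1 : F) e
  let K : Finset F := Finset.univ.filter fun e : F => e ^ q = e
  have hK : K.card ≤ q := by
    simpa [K, neg_add_eq_zero, add_neg_eq_zero] using
      card_filter_pow_add_mul_eq_le hq1 (-1 : F) 0
  have htr (x : F) : x ^ q + x ∈ K := by
    simp only [K, Finset.mem_filter, Finset.mem_univ, true_and]
    rw [hadd, hfrob, add_comm]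
  have hsum : q ^ 2 = ∑ e ∈ K, (fiber e).card := by
    rw [← hF, ← Finset.card_univ]
    exact Finset.card_eq_sum_card_fiberwise fun x _ => htr x
  have hy : -y ^ (q + 1) ∈ K := by
    simp only [K, Finset.mem_filter, Finset.mem_univ, true_and]
    have hneg (z : F) : (-z) ^ q = -z ^ q := by
      rw [eq_neg_iff_add_eq_zero, ← hadd, neg_add_cancel, zero_pow (by omega)]
    rw [hneg, pow_succ, mul_pow, hfrob, mul_comm]
  have hfy : (Finset.univ.filter fun x : F => x ^ q + x + y ^ (q + 1) = 0)
      = fiber (-y ^ (q + 1)) := by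
    ext x
    simp [fiber, eq_neg_iff_add_eq_zero]
  rw [hfy]
  by_contra! hlt
  have : ∑ e ∈ K, (fiber e).card < ∑ _e ∈ K, q :=
    Finset.sum_lt_sum (fun e _ => hfib e) ⟨_, hy, hlt⟩
  rw [Finset.sum_const, smul_eq_mul, ← hsum] at this
  nlinarith

open Polynomial in
/-- If `s ^ (q + 1) = γ`, then `s ^ (i + q * j)` is a polynomial in `s` of degree less than `q`,
as long as `i, j < q` and `j ≠ i + 1`. -/
theorem exists_degree_le_eval_eq_pow {F : Type*} [Field F] {q i j : ℕ} (hi : i < q) (hj : j < q)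
    (hij : j ≠ i + 1) (γ c : F) :
    ∃ g : F[X], g.degree ≤ ((q - 1 : ℕ) : WithBot ℕ) ∧
      ∀ t : F, (t + c) ^ (q + 1) = γ → (t + c) ^ (i + q * j) = g.eval t := by
  have key (m k n : ℕ) (hm : m ≤ q - 1) (hn : n = (q + 1) * k + m) :
      ∃ g : F[X], g.degree ≤ ((q - 1 : ℕ) : WithBot ℕ) ∧
        ∀ t : F, (t + c) ^ (q + 1) = γ → (t + c) ^ n = g.eval t := by
    refine ⟨γ ^ k • (X + C c) ^ m, ?_, fun t ht => ?_⟩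
    · refine (degree_smul_le _ _).trans ?_
      rw [degree_pow, degree_X_add_C, nsmul_one]
      exact_mod_cast hm
    · rw [hn, pow_add, pow_mul, ht]
      simp
  rcases le_or_gt j i with h | h
  · obtain ⟨d, rfl⟩ := Nat.exists_eq_add_of_le h
    exact key d j _ (by omega) (by ring)
  · obtain ⟨d, rfl⟩ : ∃ d, j = i + d + 2 := ⟨j - i - 2, by omega⟩
    obtain ⟨e, rfl⟩ : ∃ e, q = d + e + 1 := ⟨q - d - 1, by omega⟩
    exact key e (i + d + 1) _ (by omega) (by ring)

open Polynomial in
/-- The monomial `x ^ (p * a) * y ^ (p * b + q * (p * c))` restricts to a polynomial of degree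
less than `q` on the points of the Hermitian curve lying on any line `x = α y + β`. -/
theorem exists_degree_le_eval_line {F : Type*} [Field F] {p l q : ℕ} (hp : p.Prime)
    (hq : q = p ^ l) [CharP F p] {a b c : ℕ} (hab : p * (a + b) < q) (hc : p * c < q)
    (α β : F) (hα : α ^ q ^ 2 = α) :
    ∃ g : F[X], g.degree ≤ ((q - 1 : ℕ) : WithBot ℕ) ∧
      ∀ t : F, t ^ (q + 1) + α ^ q * t ^ q + α * t + (β + β ^ q) = 0 →
        (α * t + β) ^ (p * a) * t ^ (p * b + q * (p * c)) = g.eval t := by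
  have := Fact.mk hp
  set γ := α ^ (q + 1) - (β + β ^ q)
  have hnorm (t : F) (ht : t ^ (q + 1) + α ^ q * t ^ q + α * t + (β + β ^ q) = 0) :
      (t + α ^ q) ^ (q + 1) = γ := by
    have : (t + α ^ q) ^ q = t ^ q + α := by
      have hadd (x z : F) : (x + z) ^ q = x ^ q + z ^ q := by
        rw [hq, add_pow_char_pow]
      rw [hadd, ← pow_mul, ← sq, hα]
    rw [pow_succ, this]
    linear_combination ht
  have hg (i j : ℕ) (hi : i ∈ Finset.range (a + b + 1)) (hj : j ∈ Finset.range (c + 1)) :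
      ∃ g : F[X], g.degree ≤ ((q - 1 : ℕ) : WithBot ℕ) ∧
        ∀ t : F, (t + α ^ q) ^ (q + 1) = γ →
          (t + α ^ q) ^ (p * i + q * (p * j)) = g.eval t := by
    rw [Finset.mem_range] at hi hj
    refine exists_degree_le_eval_eq_pow ?_ ?_ ?_ γ _
    · exact (Nat.mul_le_mul_left p (by omega)).trans_lt hab
    · exact (Nat.mul_le_mul_left p (by omega)).trans_lt hc
    · intro h
      have h1 : p ∣ p * i + 1 := h ▸ dvd_mul_right p j
      exact hp.one_lt.ne' (Nat.dvd_one.1 ((Nat.dvd_add_right (dvd_mul_right p i)).1 h1))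
  choose! G hGdeg hG using hg
  let U : F[X] := (C (α ^ p) * X + C ((β - α * α ^ q) ^ p)) ^ a * (X - C ((α ^ q) ^ p)) ^ b
  let W : F[X] := (X - C ((α ^ q) ^ (q * p))) ^ c
  have hU : U.natDegree < a + b + 1 := by
    refine Nat.lt_succ_of_le (natDegree_mul_le.trans (add_le_add ?_ ?_))
    · exact (natDegree_pow_le_of_le a natDegree_linear_le).trans (by omega)
    · exact (natDegree_pow_le_of_le b (natDegree_X_sub_C_le _)).trans (by omega)
  have hW : W.natDegree < c + 1 :=
    Nat.lt_succ_of_le ((natDegree_pow_le_of_le c (natDegree_X_sub_C_le _)).trans (by omega))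
  refine ⟨∑ i ∈ Finset.range (a + b + 1), ∑ j ∈ Finset.range (c + 1),
    (U.coeff i * W.coeff j) • G i j, ?_, fun t ht => ?_⟩
  · rw [← mem_degreeLE]
    refine Submodule.sum_mem _ fun i hi => Submodule.sum_mem _ fun j hj => mem_degreeLE.2 ?_
    exact (degree_smul_le _ _).trans (hGdeg i j hi hj)
  · set s := t + α ^ q with hs
    have hUe : U.eval (s ^ p) = (α * t + β) ^ (p * a) * t ^ (p * b) := by
      simp only [U, eval_mul, eval_pow, eval_add, eval_sub, eval_C, eval_X]
      rw [← mul_pow, ← add_pow_char, ← sub_pow_char, ← pow_mul, ← pow_mul, hs]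
      congr 2 <;> ring
    have hWe : W.eval (s ^ (q * p)) = t ^ (q * (p * c)) := by
      simp only [W, eval_pow, eval_sub, eval_C, eval_X]
      rw [hq, ← pow_succ, ← sub_pow_char_pow, ← hq, hs, add_sub_cancel_right, hq, ← pow_mul,
        pow_succ, mul_assoc]
    rw [pow_add, ← mul_assoc, ← hUe, ← hWe, eval_eq_sum_range' hU, eval_eq_sum_range' hW,
      Finset.sum_mul_sum, eval_finsetSum]
    refine Finset.sum_congr rfl fun i hi => ?_
    rw [eval_finsetSum]
    refine Finset.sum_congr rfl fun j hj => ?_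
    rw [eval_smul, smul_eq_mul, ← hG i j hi hj t (hnorm t ht), pow_add, ← hs]
    ring

/-- Main theorem: for `q = p^l` with `p` an odd prime and `l ≥ 2`, the rate of the
Hermitian-lifted code `C_q` (its `F_{q^2}`-dimension divided by its length `q^3`) is at
least `0.469 / (p^4 (p-1) (p^3-p^2+1))`. -/
theorem hermitian_lifted_code_rate_odd (p l q : ℕ) (hp : p.Prime) (hodd : Odd p)
    (hl : 2 ≤ l) (hq : q = p ^ l)
    (F : Type*) [Field F] [Fintype F] (hF : Fintype.card F = q ^ 2) :
    (0.469 : ℝ) / (p ^ 4 * (p - 1) * (p ^ 3 - p ^ 2 + 1)) ≤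
      (Module.finrank F (Submodule.span F
        {v : {pt : F × F // pt.1 ^ q + pt.1 + pt.2 ^ (q + 1) = 0} → F |
          ∃ f : MvPolynomial (Fin 2) F,
            (∀ α β : F, ∃ g : Polynomial F, g.degree ≤ ((q - 1 : ℕ) : WithBot ℕ) ∧
              ∀ t : F, t ^ (q + 1) + α ^ q * t ^ q + α * t + (β + β ^ q) = 0 →
                MvPolynomial.eval ![α * t + β, t] f = g.eval t) ∧
            ∀ P, v P = MvPolynomial.eval ![P.1.1, P.1.2] f}) : ℝ) / q ^ 3 := by
  classical
  have := Fact.mk hp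
  obtain ⟨k, rfl⟩ := Nat.exists_eq_add_of_le' hl
  have : CharP F p := charP_of_card_eq_prime_pow (f := (k + 2) * 2) (by rw [hF, hq, pow_mul])
  have hp2 := hp.two_le
  set N := p ^ k with hN
  have hNpos : 0 < N := pow_pos hp.pos k
  have hqN : q = p * (p * N) := by rw [hq, hN]; ring
  have hbound {n : ℕ} (hn : n < p * N) : p * n < q :=
    hqN ▸ Nat.mul_lt_mul_of_pos_left hn hp.pos
  let e (i : Fin N × Fin (p * N)) : ℕ := p * i.1 + q * (p * i.2)
  let v (i : Fin N × Fin N × Fin (p * N))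
      (P : {pt : F × F // pt.1 ^ q + pt.1 + pt.2 ^ (q + 1) = 0}) : F :=
    P.1.1 ^ (p * (i.1 : ℕ)) * P.1.2 ^ e i.2
  have hNlt {n : ℕ} (hn : n < N) : n < p * N := by nlinarith
  have he_lt (i) : e i < q ^ 2 := by
    have h1 := hbound (hNlt i.1.2)
    have h2 := hbound i.2.2
    simp only [e]
    nlinarith
  have he_inj : Function.Injective e := by
    rintro ⟨b, c⟩ ⟨b', c'⟩ h
    have h1 := hbound (hNlt b.2)
    have h1' := hbound (hNlt b'.2)
    simp only [e] at h
    have hmod := congrArg (· % q) h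
    have hdiv := congrArg (· / q) h
    have hq0 : 0 < q := by omega
    simp only [Nat.add_mul_mod_self_left, Nat.mod_eq_of_lt h1, Nat.mod_eq_of_lt h1'] at hmod
    simp only [Nat.add_mul_div_left _ _ hq0, Nat.div_eq_of_lt h1, Nat.div_eq_of_lt h1',
      zero_add] at hdiv
    exact Prod.ext (Fin.ext (Nat.eq_of_mul_eq_mul_left hp.pos hmod))
      (Fin.ext (Nat.eq_of_mul_eq_mul_left hp.pos hdiv))
  have hli : LinearIndependent F v := by
    refine Fintype.linearIndependent_iff.2 fun g hg => ?_
    have hx (a : Fin N) (y : F) : ∑ i, g (a, i) * y ^ e i = 0 := by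
      refine eq_zero_of_sum_mul_pow_eq_zero
        (Finset.univ.filter fun x : F => x ^ q + x + y ^ (q + 1) = 0)
        (fun a : Fin N => p * (a : ℕ))
        (fun a a' h => Fin.ext (Nat.eq_of_mul_eq_mul_left hp.pos h))
        (fun a => (hbound (hNlt a.2)).trans_le
          (le_card_hermitian_fiber hp (by omega) hq hF y))
        (fun a => ∑ i, g (a, i) * y ^ e i) (fun x hx => ?_) a
      have := congrFun hg ⟨(x, y), (Finset.mem_filter.1 hx).2⟩
      rw [Finset.sum_apply, Fintype.sum_prod_type] at this
      rw [← Pi.zero_apply (M := fun _ => F), ← this]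
      refine Finset.sum_congr rfl fun a _ => ?_
      rw [Finset.sum_mul]
      refine Finset.sum_congr rfl fun i _ => ?_
      simp only [v, Pi.smul_apply, smul_eq_mul]
      ring
    rintro ⟨a, i⟩
    exact eq_zero_of_sum_mul_pow_eq_zero Finset.univ e he_inj
      (by simpa [hF] using he_lt) (fun i => g (a, i)) (fun y _ => hx a y) i
  have hcard := finrank_span_eq_card hli
  simp only [Fintype.card_prod, Fintype.card_fin] at hcard
  have hrate : (0.469 : ℝ) / (p ^ 4 * (p - 1) * (p ^ 3 - p ^ 2 + 1)) ≤
      ((N * (N * (p * N)) : ℕ) : ℝ) / q ^ 3 := by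
    have hqR : (q : ℝ) = p * (p * N) := by exact_mod_cast hqN
    have hpR : (2 : ℝ) ≤ p := by exact_mod_cast hp2
    have hNR : (0 : ℝ) < N := by exact_mod_cast hNpos
    have hrate_eq : ((N * (N * (p * N)) : ℕ) : ℝ) / q ^ 3 = 1 / p ^ 5 := by
      rw [hqR]
      push_cast
      field_simp
    have hfac : (1 : ℝ) ≤ p ^ 3 - p ^ 2 + 1 := by nlinarith [sq_nonneg (p : ℝ)]
    have hfac' : (0.469 : ℝ) * p ≤ (p - 1) * (p ^ 3 - p ^ 2 + 1) := by nlinarith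
    have hpos : (0 : ℝ) < (p - 1) * (p ^ 3 - p ^ 2 + 1) := by nlinarith
    rw [hrate_eq, mul_assoc, div_le_div_iff₀ (by positivity) (by positivity)]
    have := mul_le_mul_of_nonneg_left hfac' (by positivity : (0 : ℝ) ≤ p ^ 4)
    linarith
  refine hrate.trans (div_le_div_of_nonneg_right (Nat.cast_le.2 (hcard.ge.trans
    (Submodule.finrank_mono (Submodule.span_mono (Set.range_subset_iff.2 fun i =>
      ⟨MvPolynomial.X 0 ^ (p * (i.1 : ℕ)) * MvPolynomial.X 1 ^ e i.2, fun α β => ?_,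
        fun P => by simp [v]⟩))))) (by positivity))
  simpa using exists_degree_le_eval_line hp hq (a := i.1) (b := i.2.1) (c := i.2.2)
    (hbound (by have := i.1.2; have := i.2.1.2; nlinarith)) (hbound i.2.2.2) α β
    (by rw [← hF, FiniteField.pow_card])
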